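/- Let U ⊆ ℂⁿ be an open, connected and dense subset, and let H ⊆ ℂⁿ be the zero set of a nonzero polynomial in n complex variables. Then U ∖ H is an open, connected and dense subset of ℂⁿ. -/

import Mathlib

open Topology Filter

/-- A polynomial which does not vanish at `y` has only finitely many zeros on the complex line
through `x` and `y`. -/
lemma MvPolynomial.finite_setOf_eval_line_eq_zero {σ : Type*} (p : MvPolynomial σ ℂ) (x y : σ → ℂ)
    (hy : MvPolynomial.eval y p ≠ 0) :
    {t : ℂ | MvPolynomial.eval (x + t • (y - x)) p = 0}.Finite := by
  set q : Polynomial ℂ := MvPolynomial.aeval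
    (fun i => Polynomial.C (x i) + Polynomial.X * Polynomial.C (y i - x i)) p with hq
  have heval (t : ℂ) : q.eval t = MvPolynomial.eval (x + t • (y - x)) p := by
    rw [hq, ← Polynomial.coe_aeval_eq_eval, ← AlgHom.comp_apply, MvPolynomial.comp_aeval,
      MvPolynomial.aeval_eq_eval]
    simp only [MvPolynomial.coe_eval₂Hom, MvPolynomial.eval]
    congr 1
    ext i
    simp
  have hq0 : q ≠ 0 := by
    intro h
    have := heval 1
    rw [h] at this
    simp only [Polynomial.eval_zero, one_smul, add_sub_cancel] at this
    exact hy this.symm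
  refine (Polynomial.finite_setOfPred_isRoot hq0).subset fun t ht => ?_
  exact (heval t).trans ht

lemma MvPolynomial.dense_compl_zeros {σ : Type*} {p : MvPolynomial σ ℂ} (hp : p ≠ 0) :
    Dense {x | MvPolynomial.eval x p = 0}ᶜ := by
  obtain ⟨y, hy⟩ : ∃ y, MvPolynomial.eval y p ≠ 0 := by
    by_contra! h
    exact hp (MvPolynomial.funext fun x => by simp [h x])
  intro x
  have hfin := MvPolynomial.finite_setOf_eval_line_eq_zero p x y hy
  have hlim : Tendsto (fun t : ℂ => x + t • (y - x)) (𝓝[≠] 0) (𝓝 x) := by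
    have : Continuous fun t : ℂ => x + t • (y - x) := by fun_prop
    simpa using (this.tendsto 0).mono_left nhdsWithin_le_nhds
  refine mem_closure_of_tendsto hlim ?_
  exact nhdsNE_le_cofinite 0 hfin.eventually_cofinite_notMem

/-- The complement of a polynomial zero set in a convex open set is preconnected: two points are
joined by a parabolic arc in the complex line through them which avoids the zeros. -/
lemma MvPolynomial.isPreconnected_convex_diff_zeros {σ : Type*} (p : MvPolynomial σ ℂ)
    {W : Set (σ → ℂ)} (hW : IsOpen W) (hconv : Convex ℝ W) :
    IsPreconnected (W \ {x | MvPolynomial.eval x p = 0}) := by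
  refine isPreconnected_of_forall_pair fun x hx y hy => ?_
  have hfin := MvPolynomial.finite_setOf_eval_line_eq_zero p x y hy.2
  let γ : ℝ → ℝ → ℂ := fun s t => ⟨t, s * (t * (1 - t))⟩
  have hγ : Continuous fun z : ℝ × ℝ => γ z.1 z.2 :=
    Complex.equivRealProdCLM.symm.continuous.comp
      (f := fun z : ℝ × ℝ => (z.2, z.1 * (z.2 * (1 - z.2)))) (by fun_prop)
  let F : ℝ → ℝ → σ → ℂ := fun s t => x + γ s t • (y - x)
  have hF : Continuous fun z : ℝ × ℝ => F z.1 z.2 := by fun_prop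
  have hmem : ∀ᶠ s in 𝓝 (0 : ℝ), ∀ t ∈ Set.Icc (0 : ℝ) 1, F s t ∈ W := by
    refine isCompact_Icc.eventually_forall_of_forall_eventually fun t ht => ?_
    refine hF.continuousAt.eventually_mem (hW.mem_nhds ?_)
    have : F 0 t = x + t • (y - x) := by
      ext i
      simp [F, γ, ← Complex.ofReal_def]
    rw [this]
    exact hconv.add_smul_sub_mem hx.1 hy.1 ht
  have havoid : ∀ᶠ s in 𝓝[≠] (0 : ℝ), s ∉ (fun r : ℂ => r.im / (r.re * (1 - r.re))) ''
      {t : ℂ | MvPolynomial.eval (x + t • (y - x)) p = 0} :=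
    nhdsNE_le_cofinite 0 (hfin.image _).eventually_cofinite_notMem
  obtain ⟨s, hs, hs'⟩ := ((hmem.filter_mono nhdsWithin_le_nhds).and havoid).exists
  have h0 : F s 0 = x := by
    have : γ s 0 = 0 := Complex.ext (by simp [γ]) (by simp [γ])
    simp [F, this]
  have h1 : F s 1 = y := by
    have : γ s 1 = 1 := Complex.ext (by simp [γ]) (by simp [γ])
    simp [F, this]
  refine ⟨F s '' Set.Icc 0 1, ?_, ⟨0, by simp, h0⟩, ⟨1, by simp, h1⟩,
    isPreconnected_Icc.image _ (hF.comp (by fun_prop : Continuous fun t => (s, t))).continuousOn⟩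
  rintro _ ⟨t, ht, rfl⟩
  refine ⟨hs t ht, fun hzero => ?_⟩
  rcases eq_or_ne t 0 with rfl | ht0
  · exact hx.2 (h0 ▸ hzero)
  rcases eq_or_ne t 1 with rfl | ht1
  · exact hy.2 (h1 ▸ hzero)
  refine hs' ⟨γ s t, hzero, ?_⟩
  have : t * (1 - t) ≠ 0 := mul_ne_zero ht0 (sub_ne_zero.2 ht1.symm)
  exact mul_div_cancel_right₀ s this

/-- Removing a set with dense complement from a preconnected open set leaves a preconnected set,
provided that this holds locally. -/
lemma IsPreconnected.diff_of_locally {X : Type*} [TopologicalSpace X] {U H : Set X}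
    (hU : IsPreconnected U) (hUopen : IsOpen U) (hdense : Dense Hᶜ)
    (hloc : ∀ x ∈ U, ∃ W ∈ 𝓝 x, W ⊆ U ∧ IsPreconnected (W \ H)) :
    IsPreconnected (U \ H) := by
  intro u v hu hv huv ⟨a, haU, hau⟩ ⟨b, hbU, hbv⟩
  by_contra hempty
  have hopen (w : Set X) : IsOpen {x | ∀ᶠ y in 𝓝 x, y ∉ H → y ∈ w} :=
    isOpen_iff_mem_nhds.2 fun x hx => eventually_eventually_nhds.2 hx
  obtain ⟨x, hxU, hxu, hxv⟩ := hU _ _ (hopen u) (hopen v) (fun x hx => by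
      obtain ⟨W, hW, hWU, hWconn⟩ := hloc x hx
      have hsub : W \ H ⊆ U \ H := Set.sdiff_subset_sdiff_left hWU
      have := isPreconnected_iff_subset_of_disjoint.1 hWconn u v hu hv (hsub.trans huv)
        (Set.not_nonempty_iff_eq_empty.1 fun h => hempty
          (h.mono (Set.inter_subset_inter_left _ hsub)))
      refine this.imp (fun h => ?_) (fun h => ?_) <;>
      · filter_upwards [hW] with y hy hyH using h ⟨hy, hyH⟩)
    ⟨a, haU.1, (hu.eventually_mem hau).mono fun _ h _ => h⟩
    ⟨b, hbU.1, (hv.eventually_mem hbv).mono fun _ h _ => h⟩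
  obtain ⟨y, hyH, ⟨hyu, hyv⟩, hyU⟩ := (hdense.inter_nhds_nonempty
    (inter_mem (inter_mem hxu hxv) (hUopen.mem_nhds hxU)))
  exact hempty ⟨y, ⟨hyU, hyH⟩, hyu hyH, hyv hyH⟩

/-- if `U ⊆ ℂⁿ` is open, connected and dense and `H` is the zero
set of a nonzero polynomial in `n` complex variables, then `U ∖ H` is open,
connected and dense in `ℂⁿ`. -/
theorem stmt_6 (n : ℕ) (U : Set (Fin n → ℂ)) (hUopen : IsOpen U)
    (hUconn : IsConnected U) (hUdense : Dense U)
    (p : MvPolynomial (Fin n) ℂ) (hp : p ≠ 0) :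
    IsOpen (U \ {x | MvPolynomial.eval x p = 0}) ∧
      IsConnected (U \ {x | MvPolynomial.eval x p = 0}) ∧
      Dense (U \ {x | MvPolynomial.eval x p = 0}) := by
  have hclosed : IsClosed {x | MvPolynomial.eval x p = 0} :=
    isClosed_eq (MvPolynomial.continuous_eval p) continuous_const
  have hdense := MvPolynomial.dense_compl_zeros hp
  have hdiff : Dense (U \ {x | MvPolynomial.eval x p = 0}) :=
    hUdense.inter_of_isOpen_left hdense hUopen
  refine ⟨hUopen.sdiff hclosed, ⟨hdiff.nonempty, ?_⟩, hdiff⟩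
  refine hUconn.isPreconnected.diff_of_locally hUopen hdense fun x hx => ?_
  obtain ⟨ε, hε, hball⟩ := Metric.isOpen_iff.1 hUopen x hx
  exact ⟨Metric.ball x ε, Metric.ball_mem_nhds x hε, hball,
    p.isPreconnected_convex_diff_zeros Metric.isOpen_ball (convex_ball x ε)⟩
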